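/- Closure of infinite Gray codes under basic operations, part 2 (Lemma 6.2(2)): if p : ℕ → ℤ is an infinite Gray code of x and x ≥ 0, then: (a) the sequence obtained by negating the head of the tail of p (i.e. q with q 0 = -(p 1) and q i = p (i+1) for i ≥ 1) is an infinite Gray code of 2*x - 1; and (b) the sequence whose head is 1 and whose tail is q is an infinite Gray code of 1 - x. -/

import Mathlib

noncomputable def tent (x : ℝ) : ℝ := 1 - 2 * |x|

def IsGrayCode (p : ℕ → ℤ) (x : ℝ) : Prop :=
  |x| ≤ 1 ∧ (∀ i, p i ∈ ({-1, 1} : Set ℤ)) ∧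
    ∀ i, tent^[i] x ≠ 0 →
      (0 < tent^[i] x → p i = 1) ∧ (tent^[i] x < 0 → p i = -1)

theorem tent_neg (x : ℝ) : tent (-x) = tent x := by
  simp [tent]

theorem tent_of_nonneg {x : ℝ} (hx : 0 ≤ x) : tent x = 1 - 2 * x := by
  rw [tent, abs_of_nonneg hx]

theorem abs_tent_le_one {x : ℝ} (hx : |x| ≤ 1) : |tent x| ≤ 1 := by
  rw [tent, abs_le]
  constructor <;> linarith [abs_nonneg x]

theorem IsGrayCode.tail {p : ℕ → ℤ} {x : ℝ} (hp : IsGrayCode p x) :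
    IsGrayCode (fun i => p (i + 1)) (tent x) :=
  ⟨abs_tent_le_one hp.1, fun i => hp.2.1 (i + 1), fun i => hp.2.2 (i + 1)⟩

/-- Negating the head of a Gray code of `x` gives a Gray code of `-x`. -/
theorem IsGrayCode.neg_head {p : ℕ → ℤ} {x : ℝ} (hp : IsGrayCode p x) :
    IsGrayCode (fun i => if i = 0 then -(p 0) else p i) (-x) := by
  obtain ⟨hx, hdigit, hsign⟩ := hp
  refine ⟨by rwa [abs_neg], fun i => ?_, fun i => ?_⟩
  · rcases i with _ | i
    · rcases hdigit 0 with h | h <;> simp_all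
    · exact hdigit (i + 1)
  · rcases i with _ | i
    · intro h
      have hx0 : x ≠ 0 := neg_ne_zero.mp h
      refine ⟨fun hpos => ?_, fun hneg => ?_⟩
      · simp [(hsign 0 hx0).2 (neg_pos.mp hpos)]
      · simp [(hsign 0 hx0).1 (neg_neg_iff_pos.mp hneg)]
    · simpa [tent_neg] using hsign (i + 1)

theorem IsGrayCode.cons_one {q : ℕ → ℤ} {x : ℝ} (hx : 0 ≤ x) (hx' : x ≤ 1)
    (hq : IsGrayCode q (tent x)) :
    IsGrayCode (fun i => if i = 0 then 1 else q (i - 1)) x := by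
  refine ⟨abs_le.mpr ⟨by linarith, hx'⟩, fun i => ?_, fun i => ?_⟩
  · rcases i with _ | i
    · simp
    · exact hq.2.1 i
  · rcases i with _ | i
    · exact fun _ => ⟨fun _ => rfl, fun hneg => absurd hneg hx.not_gt⟩
    · exact hq.2.2 i

theorem gray_code_closure_two (p : ℕ → ℤ) (x : ℝ) (hp : IsGrayCode p x)
    (hx : x ≥ 0) :
    IsGrayCode (fun i => if i = 0 then -(p 1) else p (i + 1)) (2 * x - 1) ∧
    IsGrayCode
      (fun i => if i = 0 then 1 else
        (fun j => if j = 0 then -(p 1) else p (j + 1)) (i - 1)) (1 - x) := by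
  have hx1 : x ≤ 1 := (abs_le.mp hp.1).2
  have hq : IsGrayCode (fun i => if i = 0 then -(p 1) else p (i + 1)) (2 * x - 1) := by
    have h := hp.tail.neg_head
    rwa [tent_of_nonneg hx, neg_sub] at h
  have ht : tent (1 - x) = 2 * x - 1 := by
    rw [tent_of_nonneg (sub_nonneg.mpr hx1)]
    ring
  exact ⟨hq, IsGrayCode.cons_one (sub_nonneg.mpr hx1) (sub_le_self 1 hx) (ht.symm ▸ hq)⟩
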